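/- arXiv:2210.02602 — 2 statements merged into one kernel-verified Lean document; each statement's English description precedes it below -/
import Mathlib

section
/- Let b ∈ ℝ^m and x† ∈ ℝⁿ satisfy A x† = b and x† ∈ N(A)^⊥ (the minimum-norm solution of the consistent system Ax = b). Let y₀ ∈ ℝⁿ be arbitrary and define y_{k+1} = Q y_k + A_SᵀM b, and set e_k = y_k − P_{N(A)}y₀ − x†. Then e_k ∈ N(A)^⊥ for every k ≥ 0. -/
open Matrix

noncomputable section

/-- The Euclidean norm on `Fin k → ℝ`. -/
def euclNorm {k : ℕ} (x : Fin k → ℝ) : ℝ := Real.sqrt (∑ i, x i ^ 2)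

/-- The orthogonal projection `Pᵢ = I − aᵢaᵢᵀ/‖aᵢ‖₂²` onto the hyperplane `{x : aᵢᵀx = 0}`,
where `aᵢ` is the `i`-th row of `A`. -/
def projMat {m n : ℕ} (A : Matrix (Fin m) (Fin n) ℝ) (i : Fin m) :
    Matrix (Fin n) (Fin n) ℝ :=
  1 - (euclNorm (A i) ^ 2)⁻¹ • Matrix.vecMulVec (A i) (A i)

/-- `Q = P_m P_{m−1} ⋯ P₁` (rows 0-indexed, so `Q = P_{m−1} ⋯ P₀`). -/
def Qmat {m n : ℕ} (A : Matrix (Fin m) (Fin n) ℝ) : Matrix (Fin n) (Fin n) ℝ :=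
  ((List.finRange m).reverse.map (projMat A)).prod

/-- `Q_j = P_m P_{m−1} ⋯ P_{j+1}` (rows 0-indexed, so row `j` gets `P_{m−1} ⋯ P_{j+1}`);
in particular the last one is the identity. -/
def Qpart {m n : ℕ} (A : Matrix (Fin m) (Fin n) ℝ) (j : Fin m) : Matrix (Fin n) (Fin n) ℝ :=
  (((List.finRange m).drop ((j : ℕ) + 1)).reverse.map (projMat A)).prod

/-- `A_S`: the `j`-th row is `Q_j a_j`. -/
def AS {m n : ℕ} (A : Matrix (Fin m) (Fin n) ℝ) : Matrix (Fin m) (Fin n) ℝ :=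
  Matrix.of fun j => (Qpart A j).mulVec (A j)

/-- `M = diag(1/‖a₁‖₂², …, 1/‖a_m‖₂²)`. -/
def Mdiag {m n : ℕ} (A : Matrix (Fin m) (Fin n) ℝ) : Matrix (Fin m) (Fin m) ℝ :=
  Matrix.diagonal fun i => (euclNorm (A i) ^ 2)⁻¹

/-- The spectral norm of a matrix: the operator norm of the induced linear map
between Euclidean spaces. -/
def spec {k l : ℕ} (B : Matrix (Fin k) (Fin l) ℝ) : ℝ :=
  ‖LinearMap.toContinuousLinearMap (Matrix.toEuclideanLin B)‖

/-- `σ` is a singular value of the square matrix `B`: `σ ≥ 0` and `σ²` is an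
eigenvalue of `BᵀB`. -/
def IsSingularValue {k : ℕ} (B : Matrix (Fin k) (Fin k) ℝ) (σ : ℝ) : Prop :=
  0 ≤ σ ∧ ∃ x : Fin k → ℝ, x ≠ 0 ∧ (Bᵀ * B).mulVec x = (σ ^ 2) • x

/-- The projection `Pᵢ` preserves inner products with vectors of `N(A)`. -/
theorem projMat_mulVec_dotProduct {m n : ℕ} {A : Matrix (Fin m) (Fin n) ℝ} {z : Fin n → ℝ}
    (hz : A.mulVec z = 0) (i : Fin m) (x : Fin n → ℝ) :
    (projMat A i).mulVec x ⬝ᵥ z = x ⬝ᵥ z := by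
  have h : A i ⬝ᵥ z = 0 := congrFun hz i
  simp [projMat, sub_mulVec, smul_mulVec, vecMulVec_mulVec, sub_dotProduct, h]

/-- Products of the projections `Pᵢ` preserve inner products with vectors of `N(A)`. -/
theorem prod_projMat_mulVec_dotProduct {m n : ℕ} {A : Matrix (Fin m) (Fin n) ℝ} {z : Fin n → ℝ}
    (hz : A.mulVec z = 0) (l : List (Fin m)) (x : Fin n → ℝ) :
    (l.map (projMat A)).prod.mulVec x ⬝ᵥ z = x ⬝ᵥ z := by
  induction l with
  | nil => simp
  | cons i l ih =>
    rw [List.map_cons, List.prod_cons, ← mulVec_mulVec, projMat_mulVec_dotProduct hz, ih]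

/-- `N(A)` is contained in `N(A_S)`. -/
theorem AS_mulVec_eq_zero {m n : ℕ} {A : Matrix (Fin m) (Fin n) ℝ} {z : Fin n → ℝ}
    (hz : A.mulVec z = 0) : (AS A).mulVec z = 0 := by
  funext j
  exact (prod_projMat_mulVec_dotProduct hz _ (A j)).trans (congrFun hz j)

/-- with `x†` the minimum-norm solution of the consistent system
`Ax = b` and `e_k = y_k − P_{N(A)}y₀ − x†`, one has `e_k ∈ N(A)^⊥` for all `k`. -/
theorem stmt9 {m n : ℕ} (A : Matrix (Fin m) (Fin n) ℝ) (hA : ∀ i, A i ≠ 0)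
    (b : Fin m → ℝ) (xd : Fin n → ℝ) (hxd1 : A.mulVec xd = b)
    (hxd2 : ∀ z : Fin n → ℝ, A.mulVec z = 0 → xd ⬝ᵥ z = 0)
    (y : ℕ → Fin n → ℝ)
    (hy : ∀ k, y (k + 1) = (Qmat A).mulVec (y k) + (AS A)ᵀ.mulVec ((Mdiag A).mulVec b))
    (Py0 : Fin n → ℝ) (hPy0a : A.mulVec Py0 = 0)
    (hPy0b : ∀ z : Fin n → ℝ, A.mulVec z = 0 → (y 0 - Py0) ⬝ᵥ z = 0) :
    ∀ k, ∀ z : Fin n → ℝ, A.mulVec z = 0 → (y k - Py0 - xd) ⬝ᵥ z = 0 := by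
  intro k z hz
  have hconst : y k ⬝ᵥ z = y 0 ⬝ᵥ z := by
    induction k with
    | zero => rfl
    | succ k ih =>
      have hQ : (Qmat A).mulVec (y k) ⬝ᵥ z = y k ⬝ᵥ z := prod_projMat_mulVec_dotProduct hz _ _
      rw [hy, add_dotProduct, hQ, ih, mulVec_transpose, ← dotProduct_mulVec,
        AS_mulVec_eq_zero hz, dotProduct_zero, add_zero]
  have h0 := hPy0b z hz
  rw [sub_dotProduct] at h0
  rw [sub_dotProduct, sub_dotProduct, hconst, h0, hxd2 z hz, sub_zero]

end
end

section
/- Let b ∈ ℝ^m and x† ∈ ℝⁿ satisfy A x† = b and x† ∈ N(A)^⊥. Let y₀ ∈ ℝⁿ be arbitrary, define y_{k+1} = (I − A_SᵀMA) y_k + A_SᵀM b, and set e_k = y_k − P_{N(A)}y₀ − x†. Let 𝒦̄ = max({σ² : σ is a singular value of Q with σ < 1} ∪ {0}). Then 0 ≤ 𝒦̄ < 1, and for every k ≥ 0, ‖e_{k+1}‖₂² ≤ 𝒦̄ ‖e_k‖₂² and ‖e_{k+1}‖₂² ≤ 𝒦̄^{k+1} ‖e₀‖₂²; consequently y_k converges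 to P_{N(A)}y₀ + x† as k → ∞. -/
open Matrix

noncomputable section

theorem euclNorm_sq {k : ℕ} (x : Fin k → ℝ) : euclNorm x ^ 2 = x ⬝ᵥ x := by
  rw [euclNorm, Real.sq_sqrt (Finset.sum_nonneg fun i _ => sq_nonneg _)]
  simp [dotProduct, sq]

/-- A real symmetric matrix has Rayleigh quotient at most `c` at any vector orthogonal to all
eigenvectors with eigenvalue larger than `c`. -/
theorem dotProduct_mulVec_self_le_of_eigenvectors {k : ℕ} {H : Matrix (Fin k) (Fin k) ℝ}
    (hH : H.IsHermitian) {c : ℝ} {x : Fin k → ℝ}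
    (h : ∀ (μ : ℝ) (v : Fin k → ℝ), v ≠ 0 → H *ᵥ v = μ • v → μ ≤ c ∨ x ⬝ᵥ v = 0) :
    x ⬝ᵥ H *ᵥ x ≤ c * (x ⬝ᵥ x) := by
  have expand (u w : Fin k → ℝ) : u ⬝ᵥ w = ∑ i,
      (u ⬝ᵥ ⇑(hH.eigenvectorBasis i)) * (w ⬝ᵥ ⇑(hH.eigenvectorBasis i)) := by
    have := hH.eigenvectorBasis.sum_inner_mul_inner (WithLp.toLp 2 u) (WithLp.toLp 2 w)
    simp only [EuclideanSpace.inner_eq_star_dotProduct, star_trivial] at this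
    rw [dotProduct_comm u w, ← this]
    exact Finset.sum_congr rfl fun i _ => by rw [dotProduct_comm u]
  have coeff (i : Fin k) : (H *ᵥ x) ⬝ᵥ ⇑(hH.eigenvectorBasis i) =
      hH.eigenvalues i * (x ⬝ᵥ ⇑(hH.eigenvectorBasis i)) := by
    have hT : Hᵀ = H := by simpa using hH.eq
    rw [← vecMul_transpose, ← dotProduct_mulVec, hT, hH.mulVec_eigenvectorBasis,
      dotProduct_smul, smul_eq_mul]
  rw [expand x (H *ᵥ x), expand x x, Finset.mul_sum]
  refine Finset.sum_le_sum fun i _ => ?_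
  rw [coeff]
  have hv : (⇑(hH.eigenvectorBasis i) : Fin k → ℝ) ≠ 0 := fun h0 =>
    hH.eigenvectorBasis.orthonormal.ne_zero i (by ext j; exact congrFun h0 j)
  rcases h _ _ hv (hH.mulVec_eigenvectorBasis i) with hle | h0
  · nlinarith [mul_le_mul_of_nonneg_right hle
      (mul_self_nonneg (x ⬝ᵥ ⇑(hH.eigenvectorBasis i)))]
  · simp [h0]

section Projections

variable {m n : ℕ} (A : Matrix (Fin m) (Fin n) ℝ)

theorem projMat_mulVec (i : Fin m) (x : Fin n → ℝ) :
    projMat A i *ᵥ x = x - ((A i ⬝ᵥ A i)⁻¹ * (A i ⬝ᵥ x)) • A i := by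
  ext j
  simp [projMat, sub_mulVec, smul_mulVec, vecMulVec_mulVec, euclNorm_sq]
  ring

theorem dotProduct_self_projMat_mulVec (hA : ∀ i, A i ≠ 0) (i : Fin m) (x : Fin n → ℝ) :
    (projMat A i *ᵥ x) ⬝ᵥ (projMat A i *ᵥ x) =
      x ⬝ᵥ x - (A i ⬝ᵥ A i)⁻¹ * (A i ⬝ᵥ x) ^ 2 := by
  have h0 : A i ⬝ᵥ A i ≠ 0 := fun h => hA i (dotProduct_self_eq_zero.mp h)
  simp only [projMat_mulVec, sub_dotProduct, dotProduct_sub, smul_dotProduct, dotProduct_smul,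
    smul_eq_mul, dotProduct_comm x (A i)]
  field_simp
  ring

theorem dotProduct_self_projMat_mulVec_le (hA : ∀ i, A i ≠ 0) (i : Fin m) (x : Fin n → ℝ) :
    (projMat A i *ᵥ x) ⬝ᵥ (projMat A i *ᵥ x) ≤ x ⬝ᵥ x := by
  rw [dotProduct_self_projMat_mulVec A hA]
  have : 0 ≤ A i ⬝ᵥ A i := by rw [← euclNorm_sq]; positivity
  have : 0 ≤ (A i ⬝ᵥ A i)⁻¹ * (A i ⬝ᵥ x) ^ 2 := by positivity
  linarith

theorem list_prod_projMat_mulVec_of_orthogonal (L : List (Fin m)) {x : Fin n → ℝ}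
    (hx : ∀ i ∈ L, A i ⬝ᵥ x = 0) : (L.map (projMat A)).prod *ᵥ x = x := by
  induction L with
  | nil => simp
  | cons i L ih =>
    rw [List.map_cons, List.prod_cons, ← mulVec_mulVec,
      ih fun j hj => hx j (List.mem_cons_of_mem _ hj), projMat_mulVec,
      hx i List.mem_cons_self]
    simp

theorem dotProduct_self_list_prod_projMat_mulVec_le (hA : ∀ i, A i ≠ 0) (L : List (Fin m))
    (x : Fin n → ℝ) :
    ((L.map (projMat A)).prod *ᵥ x) ⬝ᵥ ((L.map (projMat A)).prod *ᵥ x) ≤ x ⬝ᵥ x := by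
  induction L with
  | nil => simp
  | cons i L ih =>
    rw [List.map_cons, List.prod_cons, ← mulVec_mulVec]
    exact (dotProduct_self_projMat_mulVec_le A hA i _).trans ih

/-- A product of the projections preserves the length only of vectors orthogonal to all the rows
involved. -/
theorem orthogonal_of_le_dotProduct_self_list_prod_projMat_mulVec (hA : ∀ i, A i ≠ 0)
    (L : List (Fin m)) {x : Fin n → ℝ}
    (hx : x ⬝ᵥ x ≤ ((L.map (projMat A)).prod *ᵥ x) ⬝ᵥ ((L.map (projMat A)).prod *ᵥ x)) :
    ∀ i ∈ L, A i ⬝ᵥ x = 0 := by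
  induction L with
  | nil => simp
  | cons i L ih =>
    rw [List.map_cons, List.prod_cons, ← mulVec_mulVec] at hx
    have hL := ih (hx.trans (dotProduct_self_projMat_mulVec_le A hA i _))
    rw [list_prod_projMat_mulVec_of_orthogonal A L hL, dotProduct_self_projMat_mulVec A hA] at hx
    have hpos : 0 < A i ⬝ᵥ A i := by
      have h0 : A i ⬝ᵥ A i ≠ 0 := fun h => hA i (dotProduct_self_eq_zero.mp h)
      have : 0 ≤ A i ⬝ᵥ A i := by rw [← euclNorm_sq]; positivity
      exact lt_of_le_of_ne this h0.symm
    have hi : A i ⬝ᵥ x = 0 := by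
      by_contra hne
      have : 0 < (A i ⬝ᵥ A i)⁻¹ * (A i ⬝ᵥ x) ^ 2 := by positivity
      linarith
    simpa [hi] using hL

theorem list_prod_projMat_mulVec_dotProduct (L : List (Fin m)) (x : Fin n → ℝ) {z : Fin n → ℝ}
    (hz : A *ᵥ z = 0) : ((L.map (projMat A)).prod *ᵥ x) ⬝ᵥ z = x ⬝ᵥ z := by
  induction L with
  | nil => simp
  | cons i L ih =>
    have hi : A i ⬝ᵥ z = 0 := congrFun hz i
    rw [List.map_cons, List.prod_cons, ← mulVec_mulVec, projMat_mulVec, sub_dotProduct,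
      smul_dotProduct, hi, smul_zero, sub_zero, ih]

theorem one_sub_AS_transpose_mul_Mdiag_mul :
    (1 : Matrix (Fin n) (Fin n) ℝ) - (AS A)ᵀ * Mdiag A * A = Qmat A := by
  let T : ℕ → Matrix (Fin n) (Fin n) ℝ := fun k =>
    (((List.finRange m).drop k).reverse.map (projMat A)).prod
  have step (j : Fin m) : T j = T (j + 1) * projMat A j := by
    have hdrop : (List.finRange m).drop j = j :: (List.finRange m).drop (j + 1) := by
      rw [List.drop_eq_getElem_cons (by simp)]
      simp
    simp only [T, hdrop, List.reverse_cons, List.map_append, List.prod_append]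
    simp
  have telescope : ∑ j : Fin m, (T (j + 1) - T j) = 1 - Qmat A := by
    rw [Fin.sum_univ_eq_sum_range (fun j => T (j + 1) - T j), Finset.sum_range_sub]
    simp [T, Qmat, List.drop_of_length_le]
  have term (j : Fin m) : T (j + 1) - T j =
      (euclNorm (A j) ^ 2)⁻¹ • vecMulVec (AS A j) (A j) := by
    rw [step, projMat, Matrix.mul_sub, Matrix.mul_one, sub_sub_cancel, Matrix.mul_smul,
      mul_vecMulVec]
    rfl
  rw [sub_eq_iff_eq_add, ← sub_eq_iff_eq_add', ← telescope]
  ext p q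
  rw [Matrix.mul_apply, Matrix.sum_apply]
  refine Finset.sum_congr rfl fun j _ => ?_
  rw [term, Mdiag, Matrix.mul_diagonal, Matrix.smul_apply, vecMulVec_apply, transpose_apply,
    smul_eq_mul]
  ring

theorem dotProduct_Qmat_transpose_mul_Qmat_mulVec (x : Fin n → ℝ) :
    x ⬝ᵥ ((Qmat A)ᵀ * Qmat A) *ᵥ x = (Qmat A *ᵥ x) ⬝ᵥ (Qmat A *ᵥ x) := by
  rw [← mulVec_mulVec, dotProduct_mulVec, vecMul_transpose]

theorem mulVec_eq_zero_of_eigenvector (hA : ∀ i, A i ≠ 0) {μ : ℝ} (hμ : 1 ≤ μ)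
    {v : Fin n → ℝ} (hv : ((Qmat A)ᵀ * Qmat A) *ᵥ v = μ • v) : A *ᵥ v = 0 := by
  have hlen := dotProduct_Qmat_transpose_mul_Qmat_mulVec A v
  rw [hv, dotProduct_smul, smul_eq_mul] at hlen
  have hnn : 0 ≤ v ⬝ᵥ v := by rw [← euclNorm_sq]; positivity
  have hle : v ⬝ᵥ v ≤ (Qmat A *ᵥ v) ⬝ᵥ (Qmat A *ᵥ v) := by nlinarith
  ext i
  exact orthogonal_of_le_dotProduct_self_list_prod_projMat_mulVec A hA _ hle i (by simp)

theorem finite_sq_singularValue_lt_one {k : ℕ} (B : Matrix (Fin k) (Fin k) ℝ) :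
    {t : ℝ | ∃ σ : ℝ, IsSingularValue B σ ∧ σ < 1 ∧ t = σ ^ 2}.Finite := by
  refine (Module.End.finite_hasEigenvalue (toLin' (Bᵀ * B))).subset ?_
  rintro t ⟨σ, ⟨-, x, hx0, hx⟩, -, rfl⟩
  exact Module.End.hasEigenvalue_of_hasEigenvector
    ⟨Module.End.mem_eigenspace_iff.mpr (by rw [toLin'_apply, hx]), hx0⟩

theorem dotProduct_self_Qmat_mulVec_le (hA : ∀ i, A i ≠ 0) {c : ℝ}
    (hc : ∀ σ, IsSingularValue (Qmat A) σ → σ < 1 → σ ^ 2 ≤ c) {x : Fin n → ℝ}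
    (hx : ∀ z, A *ᵥ z = 0 → x ⬝ᵥ z = 0) :
    (Qmat A *ᵥ x) ⬝ᵥ (Qmat A *ᵥ x) ≤ c * (x ⬝ᵥ x) := by
  rw [← dotProduct_Qmat_transpose_mul_Qmat_mulVec]
  have hH : ((Qmat A)ᵀ * Qmat A).IsHermitian := isHermitian_conjTranspose_mul_self (Qmat A)
  refine dotProduct_mulVec_self_le_of_eigenvectors hH fun μ v hv0 hv => ?_
  rcases le_or_gt 1 μ with hμ | hμ
  · exact Or.inr (hx v (mulVec_eq_zero_of_eigenvector A hA hμ hv))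
  · left
    have hμ0 : 0 ≤ μ := by
      have hlen := dotProduct_Qmat_transpose_mul_Qmat_mulVec A v
      rw [hv, dotProduct_smul, smul_eq_mul, ← euclNorm_sq, ← euclNorm_sq] at hlen
      have hpos : 0 < euclNorm v ^ 2 := by
        refine lt_of_le_of_ne (sq_nonneg _) fun h => hv0 ?_
        rw [euclNorm_sq] at h
        exact dotProduct_self_eq_zero.mp h.symm
      exact nonneg_of_mul_nonneg_left (hlen ▸ sq_nonneg _) hpos
    have := hc (Real.sqrt μ) ⟨Real.sqrt_nonneg _, v, hv0, by rw [Real.sq_sqrt hμ0, hv]⟩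
      ((Real.sqrt_lt' one_pos).mpr (by simpa using hμ))
    rwa [Real.sq_sqrt hμ0] at this

end Projections

/-- with `𝒦̄ = max({σ² : σ singular value of Q, σ < 1} ∪ {0})`,
one has `0 ≤ 𝒦̄ < 1`, `‖e_{k+1}‖₂² ≤ 𝒦̄‖e_k‖₂²`, `‖e_{k+1}‖₂² ≤ 𝒦̄^{k+1}‖e₀‖₂²`,
and `y_k → P_{N(A)}y₀ + x†`. -/
theorem stmt15 {m n : ℕ} (A : Matrix (Fin m) (Fin n) ℝ) (hA : ∀ i, A i ≠ 0)
    (b : Fin m → ℝ) (xd : Fin n → ℝ) (hxd1 : A.mulVec xd = b)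
    (hxd2 : ∀ z : Fin n → ℝ, A.mulVec z = 0 → xd ⬝ᵥ z = 0)
    (y : ℕ → Fin n → ℝ)
    (hy : ∀ k, y (k + 1) =
      ((1 : Matrix (Fin n) (Fin n) ℝ) - (AS A)ᵀ * Mdiag A * A).mulVec (y k) +
        (AS A)ᵀ.mulVec ((Mdiag A).mulVec b))
    (Py0 : Fin n → ℝ) (hPy0a : A.mulVec Py0 = 0)
    (hPy0b : ∀ z : Fin n → ℝ, A.mulVec z = 0 → (y 0 - Py0) ⬝ᵥ z = 0)
    (Kbar : ℝ)
    (hKbar : Kbar =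
      sSup ({t : ℝ | ∃ σ : ℝ, IsSingularValue (Qmat A) σ ∧ σ < 1 ∧ t = σ ^ 2} ∪ {0})) :
    0 ≤ Kbar ∧ Kbar < 1 ∧
    (∀ k : ℕ,
      euclNorm (y (k + 1) - Py0 - xd) ^ 2 ≤ Kbar * euclNorm (y k - Py0 - xd) ^ 2 ∧
      euclNorm (y (k + 1) - Py0 - xd) ^ 2 ≤ Kbar ^ (k + 1) * euclNorm (y 0 - Py0 - xd) ^ 2) ∧
    Filter.Tendsto (fun k => y k) Filter.atTop (nhds (Py0 + xd)) := by
  set S := {t : ℝ | ∃ σ : ℝ, IsSingularValue (Qmat A) σ ∧ σ < 1 ∧ t = σ ^ 2} ∪ {0}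
  have hfin : S.Finite := (finite_sq_singularValue_lt_one (Qmat A)).union (Set.finite_singleton 0)
  have hK0 : 0 ≤ Kbar := hKbar ▸ le_csSup hfin.bddAbove (Or.inr rfl)
  have hK1 : Kbar < 1 := by
    rw [hKbar, hfin.csSup_lt_iff ⟨0, Or.inr rfl⟩]
    rintro t (⟨σ, ⟨hσ0, -⟩, hσ1, rfl⟩ | rfl)
    · exact pow_lt_one₀ hσ0 hσ1 two_ne_zero
    · exact one_pos
  have hc (σ : ℝ) (hσ : IsSingularValue (Qmat A) σ) (hσ1 : σ < 1) : σ ^ 2 ≤ Kbar :=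
    hKbar ▸ le_csSup hfin.bddAbove (Or.inl ⟨σ, hσ, hσ1, rfl⟩)
  have hrec (k : ℕ) : y (k + 1) - Py0 - xd = Qmat A *ᵥ (y k - Py0 - xd) := by
    have hQ (x : Fin n → ℝ) : Qmat A *ᵥ x = x - (AS A)ᵀ *ᵥ (Mdiag A *ᵥ (A *ᵥ x)) := by
      rw [← one_sub_AS_transpose_mul_Mdiag_mul, sub_mulVec, one_mulVec, ← mulVec_mulVec,
        ← mulVec_mulVec]
    rw [hy, one_sub_AS_transpose_mul_Mdiag_mul, mulVec_sub, mulVec_sub, hQ Py0, hQ xd, hPy0a,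
      hxd1, mulVec_zero, mulVec_zero]
    abel
  have horth (k : ℕ) : ∀ z, A *ᵥ z = 0 → (y k - Py0 - xd) ⬝ᵥ z = 0 := by
    induction k with
    | zero => exact fun z hz => by rw [sub_dotProduct, hPy0b z hz, hxd2 z hz, sub_zero]
    | succ k ih =>
      intro z hz
      rw [hrec, Qmat, list_prod_projMat_mulVec_dotProduct A _ _ hz, ih z hz]
  have hstep (k : ℕ) :
      euclNorm (y (k + 1) - Py0 - xd) ^ 2 ≤ Kbar * euclNorm (y k - Py0 - xd) ^ 2 := by
    rw [hrec, euclNorm_sq, euclNorm_sq]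
    exact dotProduct_self_Qmat_mulVec_le A hA hc (horth k)
  have hgeom (k : ℕ) :
      euclNorm (y k - Py0 - xd) ^ 2 ≤ Kbar ^ k * euclNorm (y 0 - Py0 - xd) ^ 2 := by
    induction k with
    | zero => simp
    | succ k ih =>
      calc _ ≤ Kbar * euclNorm (y k - Py0 - xd) ^ 2 := hstep k
        _ ≤ Kbar * (Kbar ^ k * euclNorm (y 0 - Py0 - xd) ^ 2) := by gcongr
        _ = _ := by ring
  refine ⟨hK0, hK1, fun k => ⟨hstep k, hgeom (k + 1)⟩, tendsto_pi_nhds.mpr fun i => ?_⟩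
  have hbound : Filter.Tendsto (fun k => Kbar ^ k * euclNorm (y 0 - Py0 - xd) ^ 2)
      Filter.atTop (nhds 0) := by
    simpa using (tendsto_pow_atTop_nhds_zero_of_lt_one hK0 hK1).mul_const
      (euclNorm (y 0 - Py0 - xd) ^ 2)
  have hsq : Filter.Tendsto (fun k => (y k - Py0 - xd) i ^ 2) Filter.atTop (nhds 0) := by
    refine squeeze_zero (fun k => sq_nonneg _) (fun k => ?_) hbound
    refine le_trans ?_ (hgeom k)
    rw [euclNorm_sq, sq]
    exact Finset.single_le_sum (f := fun j => (y k - Py0 - xd) j * (y k - Py0 - xd) j)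
      (fun j _ => mul_self_nonneg _) (Finset.mem_univ i)
  have habs : Filter.Tendsto (fun k => (y k - Py0 - xd) i) Filter.atTop (nhds 0) := by
    rw [tendsto_zero_iff_abs_tendsto_zero]
    simpa [Function.comp_def, Real.sqrt_sq_eq_abs] using hsq.sqrt
  simpa using! habs.add_const ((Py0 + xd) i)

end
end
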